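/- The graph F(8,12,1), defined as the simple graph on vertex set {1,...,8} with edge set {{1,2},{1,3},{1,4},{2,3},{2,5},{3,6},{4,6},{5,6},{4,7},{6,7},{6,8},{4,8}}, is forbidden: there is no injective map φ : {1,...,8} → ℝ² with dist(φ(i), φ(j)) = 1 for every edge {i,j}. -/

import Mathlib

lemma two_circ {a b p q r : EuclideanSpace ℝ (Fin 2)} (hab : a ≠ b) (hpq : p ≠ q)
    (h1 : dist p a = 1) (h2 : dist q a = 1) (h3 : dist r a = 1)
    (h4 : dist p b = 1) (h5 : dist q b = 1) (h6 : dist r b = 1) : r = p ∨ r = q :=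
  EuclideanGeometry.eq_of_dist_eq_of_dist_eq_of_finrank_eq_two (by simp) hab hpq h1 h2 h3 h4 h5 h6

/-- A unit rhombus `p, a, q, b` is a parallelogram. -/
lemma rhombus {a b p q : EuclideanSpace ℝ (Fin 2)} (hab : a ≠ b) (hpq : p ≠ q)
    (h1 : dist p a = 1) (h2 : dist q a = 1)
    (h4 : dist p b = 1) (h5 : dist q b = 1) : a + b - p = q := by
  have h3 : dist (a + b - p) a = 1 := by
    rw [← h4, dist_comm p b, dist_eq_norm, dist_eq_norm]; congr 1; abel
  have h6 : dist (a + b - p) b = 1 := by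
    rw [← h1, dist_comm p a, dist_eq_norm, dist_eq_norm]; congr 1; abel
  rcases two_circ hab hpq h1 h2 h3 h4 h5 h6 with h | h
  · exfalso
    apply hpq
    have e : a + b = p + p := sub_eq_iff_eq_add.mp h
    have hb : b = p + p - a := by rw [← e]; abel
    have key := parallelogram_law_with_norm ℝ (q - p) (a - p)
    have e1 : q - p + (a - p) = q - b := by rw [hb]; abel
    have e2 : q - p - (a - p) = q - a := by abel
    rw [e1, e2, ← dist_eq_norm, ← dist_eq_norm, ← dist_eq_norm, ← dist_eq_norm,
      h2, h5, dist_comm a p, h1] at key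
    have : dist q p = 0 := by nlinarith
    exact (dist_eq_zero.mp this).symm
  · exact h

theorem F_8_12_1_forbidden :
    ¬ ∃ φ : ℕ → EuclideanSpace ℝ (Fin 2),
      Set.InjOn φ (Set.Icc 1 8) ∧
      dist (φ 1) (φ 2) = 1 ∧
      dist (φ 1) (φ 3) = 1 ∧
      dist (φ 1) (φ 4) = 1 ∧
      dist (φ 2) (φ 3) = 1 ∧
      dist (φ 2) (φ 5) = 1 ∧
      dist (φ 3) (φ 6) = 1 ∧
      dist (φ 4) (φ 6) = 1 ∧
      dist (φ 5) (φ 6) = 1 ∧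
      dist (φ 4) (φ 7) = 1 ∧
      dist (φ 6) (φ 7) = 1 ∧
      dist (φ 6) (φ 8) = 1 ∧
      dist (φ 4) (φ 8) = 1 := by
  rintro ⟨φ, hi, h12, h13, h14, h23, h25, h36, h46, h56, h47, h67, h68, h48⟩
  have ne : ∀ i j : ℕ, 1 ≤ i → i ≤ 8 → 1 ≤ j → j ≤ 8 → i ≠ j → φ i ≠ φ j :=
    fun i j a b c d hn h => hn (hi ⟨a, b⟩ ⟨c, d⟩ h)
  have n (i j : ℕ) (h : (1 ≤ i ∧ i ≤ 8 ∧ 1 ≤ j ∧ j ≤ 8 ∧ i ≠ j) := by decide) : φ i ≠ φ j :=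
    ne i j h.1 h.2.1 h.2.2.1 h.2.2.2.1 h.2.2.2.2
  have r1 : φ 3 + φ 4 - φ 1 = φ 6 :=
    rhombus (n 3 4) (n 1 6) h13 (by rwa [dist_comm]) h14 (by rwa [dist_comm])
  have r2 : φ 3 + φ 5 - φ 2 = φ 6 :=
    rhombus (n 3 5) (n 2 6) h23 (by rwa [dist_comm]) h25 (by rwa [dist_comm])
  have h54 : dist (φ 5) (φ 4) = 1 := by
    rw [← h12, dist_comm (φ 1), dist_eq_norm, dist_eq_norm]
    congr 1
    have e : φ 3 + φ 4 - φ 1 = φ 3 + φ 5 - φ 2 := r1.trans r2.symm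
    have e' : φ 5 - φ 4 - (φ 2 - φ 1) = (φ 3 + φ 5 - φ 2) - (φ 3 + φ 4 - φ 1) := by abel
    rw [e, sub_self] at e'
    exact sub_eq_zero.mp e'
  rcases two_circ (n 4 6) (n 7 8) (by rwa [dist_comm]) (by rwa [dist_comm]) h54
    (by rwa [dist_comm]) (by rwa [dist_comm]) h56 with h | h
  · exact n 5 7 (by decide) h
  · exact n 5 8 (by decide) h
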